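/- arXiv:0812.4470 — 4 statements merged into one kernel-verified Lean document; each statement's English description precedes it below -/
import Mathlib

section
/- For every integer k ≥ 9, there exist two distinct cubefree binary words of length k each of which has 00 as a prefix and 11 as a suffix (i.e., two distinct cubefree words of the form 00x11). -/
/-- The Thue–Morse morphism θ (0 ↦ 01, 1 ↦ 10), with 0 = `false`, 1 = `true`,
applied letterwise to a word. -/
def tmMap (w : List Bool) : List Bool :=
  w.flatMap (fun b => if b then [true, false] else [false, true])

/-- A word is cubefree if it contains no non-empty factor of the form `x ++ x ++ x`. -/
def Cubefree (w : List Bool) : Prop :=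
  ∀ x : List Bool, x ≠ [] → ¬ (x ++ x ++ x) <:+: w

/-- `w` is a factor of the Thue–Morse word `t = θ^ω(0)`: since the words `θ^m(0)`
are prefixes of `t` whose lengths tend to infinity, this holds iff `w` is an
infix of `θ^m(0)` for some `m`. -/
def FactorTM (w : List Bool) : Prop :=
  ∃ m : ℕ, w <:+: tmMap^[m] [false]

/-- The binary morphism determined by `h : Bool → List Bool` is cubefree. -/
def CubefreeMorphism (h : Bool → List Bool) : Prop :=
  ∀ w : List Bool, Cubefree w → Cubefree (w.flatMap h)

/-- The Thue–Morse sequence: the parity of the number of ones in the binary expansion. -/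
def thueMorse (n : ℕ) : Bool :=
  n.bits.foldr xor false

theorem thueMorse_two_mul (n : ℕ) : thueMorse (2 * n) = thueMorse n := by
  rcases eq_or_ne n 0 with rfl | hn
  · rfl
  · simp [thueMorse, Nat.bit0_bits n hn]

theorem thueMorse_two_mul_add_one (n : ℕ) : thueMorse (2 * n + 1) = !thueMorse n := by
  simp [thueMorse]

theorem odd_of_thueMorse_eq_succ {n : ℕ} (h : thueMorse n = thueMorse (n + 1)) : n % 2 = 1 := by
  by_contra hn
  obtain ⟨m, rfl⟩ : ∃ m, n = 2 * m := ⟨n / 2, by omega⟩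
  simp [thueMorse_two_mul, thueMorse_two_mul_add_one] at h

/-- The infinite word `W` has a cube of period `q` at position `i`. -/
def CubeAt (W : ℕ → Bool) (i q : ℕ) : Prop :=
  ∀ j < 2 * q, W (i + j) = W (i + j + q)

instance (W : ℕ → Bool) (i q : ℕ) : Decidable (CubeAt W i q) :=
  inferInstanceAs (Decidable (∀ j < 2 * q, W (i + j) = W (i + j + q)))

theorem not_thueMorse_three_eq (n : ℕ) (h₁ : thueMorse n = thueMorse (n + 1))
    (h₂ : thueMorse (n + 1) = thueMorse (n + 2)) : False := by
  have := odd_of_thueMorse_eq_succ h₁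
  have := odd_of_thueMorse_eq_succ h₂
  omega

theorem CubeAt.half {i q : ℕ} (h : CubeAt thueMorse i (2 * q)) :
    CubeAt thueMorse ((i + 1) / 2) q := by
  intro j hj
  have := h (2 * ((i + 1) / 2 + j) - i) (by omega)
  rwa [show i + (2 * ((i + 1) / 2 + j) - i) = 2 * ((i + 1) / 2 + j) by omega,
    show 2 * ((i + 1) / 2 + j) + 2 * q = 2 * ((i + 1) / 2 + j + q) by omega,
    thueMorse_two_mul, thueMorse_two_mul] at this

theorem not_cubeAt_thueMorse_odd (i q : ℕ) : ¬ CubeAt thueMorse i (2 * q + 1) := by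
  intro h
  rcases Nat.eq_zero_or_pos q with rfl | hq
  · exact not_thueMorse_three_eq i (h 0 (by omega)) (h 1 (by omega))
  · have key : ∀ m, i ≤ 2 * m → 2 * m + 1 < i + 2 * (2 * q + 1) →
        thueMorse (m + q) = thueMorse (m + q + 1) := by
      intro m h₁ h₂
      have e₁ := h (2 * m - i) (by omega)
      have e₂ := h (2 * m + 1 - i) (by omega)
      rw [show i + (2 * m - i) = 2 * m by omega,
        show 2 * m + (2 * q + 1) = 2 * (m + q) + 1 by omega,
        thueMorse_two_mul, thueMorse_two_mul_add_one] at e₁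
      rw [show i + (2 * m + 1 - i) = 2 * m + 1 by omega,
        show 2 * m + 1 + (2 * q + 1) = 2 * (m + q + 1) by omega,
        thueMorse_two_mul, thueMorse_two_mul_add_one] at e₂
      rw [← e₂, e₁, Bool.not_not]
    have e₁ := key ((i + 1) / 2) (by omega) (by omega)
    have e₂ := key ((i + 1) / 2 + 1) (by omega) (by omega)
    rw [show (i + 1) / 2 + 1 + q = (i + 1) / 2 + q + 1 by omega] at e₂
    exact not_thueMorse_three_eq _ e₁ e₂

theorem not_cubeAt_thueMorse (i q : ℕ) (hq : 0 < q) : ¬ CubeAt thueMorse i q := by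
  induction q using Nat.strong_induction_on generalizing i with
  | _ q ih =>
    obtain ⟨m, rfl | rfl⟩ := Nat.even_or_odd' q
    · exact fun h => ih m (by omega) _ (by omega) h.half
    · exact not_cubeAt_thueMorse_odd i m

theorem cubefree_of_forall_not_cubeAt {w : List Bool} {W : ℕ → Bool}
    (hw : ∀ n, ∀ h : n < w.length, w[n] = W n)
    (hW : ∀ i q, 0 < q → i + 3 * q ≤ w.length → ¬ CubeAt W i q) : Cubefree w := by
  rintro x hx ⟨u, v, rfl⟩
  refine hW u.length x.length (List.length_pos_iff.mpr hx) (by simp; omega) fun j hj => ?_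
  rw [← hw _ (by simp; omega), ← hw _ (by simp; omega)]
  grind

/-- The infinite word obtained by writing `p` before the Thue–Morse word without its first three
letters, that is, before `0100110010110…`. -/
def prependTM (p : List Bool) (n : ℕ) : Bool :=
  if n < p.length then p.getD n false else thueMorse (n - p.length + 3)

theorem prependTM_of_lt {p : List Bool} {n : ℕ} (h : n < p.length) : prependTM p n = p[n] := by
  simp [prependTM, h]

theorem prependTM_add (p : List Bool) (n : ℕ) :
    prependTM p (p.length + n) = thueMorse (n + 3) := by
  simp [prependTM]

/-- A word `p` ending in `0` creates the factor `00100`, in which `00` occurs at positions of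
different parity. It does not recur further right, which bounds the period of every cube that
starts in `p`. -/
theorem not_cubeAt_prependTM {p : List Bool} (hp : p.getLast? = some false)
    (hcheck : ∀ i < p.length, ∀ q < p.length + 3, 0 < q → i + 2 * q ≤ p.length + 3 →
      ¬ CubeAt (prependTM p) i q)
    (i q : ℕ) (hq : 0 < q) : ¬ CubeAt (prependTM p) i q := by
  rcases lt_or_ge i p.length with hi | hi
  · by_cases hiq : i + 2 * q ≤ p.length + 3
    · exact hcheck i hi q (by omega) hq hiq
    · intro h
      have shift : ∀ d ≤ 4, prependTM p (p.length - 1 + d) = thueMorse (q - 1 + d + 3) := by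
        intro d hd
        have := h (p.length - 1 + d - i) (by omega)
        rwa [show i + (p.length - 1 + d - i) = p.length - 1 + d by omega,
          show p.length - 1 + d + q = p.length + (q - 1 + d) by omega, prependTM_add] at this
      have h₀ : prependTM p (p.length - 1 + 0) = false := by
        rw [List.getLast?_eq_getElem?] at hp
        rw [Nat.add_zero, prependTM_of_lt (by omega)]
        exact (List.getElem?_eq_some_iff.mp hp).2
      have h_pos : ∀ d, prependTM p (p.length - 1 + (d + 1)) = thueMorse (d + 3) := by
        intro d
        rw [← prependTM_add p d]
        congr 1
        omega
      have e₀ := h₀.symm.trans (shift 0 (by omega))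
      have e₁ := (h_pos 0).symm.trans (shift 1 (by omega))
      have e₃ := (h_pos 2).symm.trans (shift 3 (by omega))
      have e₄ := (h_pos 3).symm.trans (shift 4 (by omega))
      have o₁ := odd_of_thueMorse_eq_succ (n := q - 1 + 3) (e₀.symm.trans e₁)
      have o₂ := odd_of_thueMorse_eq_succ (n := q - 1 + 3 + 3) (e₃.symm.trans e₄)
      omega
  · obtain ⟨m, rfl⟩ := Nat.exists_eq_add_of_le hi
    intro h
    refine not_cubeAt_thueMorse (m + 3) q hq fun j hj => ?_
    have := h j hj
    rw [add_assoc, add_assoc, prependTM_add, prependTM_add] at this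
    convert this using 2 <;> omega

/-- `p` starts with `00`, ends with `0`, and no short cube starts inside `p` when it is prepended
to the Thue–Morse word without its first three letters. -/
def IsGoodPrefix (p : List Bool) : Prop :=
  p.take 2 = [false, false] ∧ p.getLast? = some false ∧
    ∀ i < p.length, ∀ q < p.length + 3, 0 < q → i + 2 * q ≤ p.length + 3 →
      ¬ CubeAt (prependTM p) i q

instance (p : List Bool) : Decidable (IsGoodPrefix p) :=
  inferInstanceAs (Decidable (_ ∧ _ ∧ _))

theorem exists_two_isGoodPrefix {n : ℕ} (h₁ : 7 ≤ n) (h₂ : n ≤ 14) :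
    ∃ p q : List Bool, p ≠ q ∧ p.length = n ∧ q.length = n ∧ IsGoodPrefix p ∧ IsGoodPrefix q := by
  interval_cases n
  · exact ⟨[false, false, true, false, true, true, false],
      [false, false, true, true, false, true, false],
      by decide, rfl, rfl, by decide +kernel, by decide +kernel⟩
  · exact ⟨[false, false, true, false, false, true, true, false],
      [false, false, true, true, false, true, true, false],
      by decide, rfl, rfl, by decide +kernel, by decide +kernel⟩
  · exact ⟨[false, false, true, false, false, true, false, true, false],
      [false, false, true, false, true, true, false, true, false],
      by decide, rfl, rfl, by decide +kernel, by decide +kernel⟩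
  · exact ⟨[false, false, true, false, false, true, false, true, true, false],
      [false, false, true, false, false, true, true, false, true, false],
      by decide, rfl, rfl, by decide +kernel, by decide +kernel⟩
  · exact ⟨[false, false, true, false, false, true, true, false, true, true, false],
      [false, false, true, false, true, false, false, true, false, true, false],
      by decide, rfl, rfl, by decide +kernel, by decide +kernel⟩
  · exact ⟨[false, false, true, false, false, true, false, true, true, false, true, false],
      [false, false, true, false, true, false, false, true, false, true, true, false],
      by decide, rfl, rfl, by decide +kernel, by decide +kernel⟩
  · exact ⟨[false, false, true, false, false, true, false, true, false, false, true, true, false],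
      [false, false, true, false, false, true, false, true, true, false, true, true, false],
      by decide, rfl, rfl, by decide +kernel, by decide +kernel⟩
  · exact ⟨[false, false, true, false, false, true, false, true, true, false, false, true, true, false],
      [false, false, true, false, false, true, true, false, false, true, false, true, true, false],
      by decide, rfl, rfl, by decide +kernel, by decide +kernel⟩

theorem exists_thueMorse_true_true (a : ℕ) : ∃ e, 1 ≤ e ∧ e ≤ 5 ∧
    thueMorse (4 * a + e) = true ∧ thueMorse (4 * a + e + 1) = true := by
  have hb : ∀ b, thueMorse (4 * b) = thueMorse b ∧ thueMorse (4 * b + 1) = !thueMorse b ∧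
      thueMorse (4 * b + 2) = !thueMorse b ∧ thueMorse (4 * b + 3) = thueMorse b := by
    intro b
    rw [show 4 * b = 2 * (2 * b) by ring, show 2 * (2 * b) + 2 = 2 * (2 * b + 1) by ring,
      show 2 * (2 * b) + 3 = 2 * (2 * b + 1) + 1 by ring]
    simp [thueMorse_two_mul, thueMorse_two_mul_add_one]
  obtain ⟨-, a₁, a₂, a₃⟩ := hb a
  obtain ⟨b₀, b₁, b₂, -⟩ := hb (a + 1)
  cases ha : thueMorse a
  · exact ⟨1, by omega, by omega, by simp [a₁, ha], by simp [a₂, ha]⟩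
  · cases hs : thueMorse (a + 1)
    · exact ⟨5, by omega, by omega, by rw [show 4 * a + 5 = 4 * (a + 1) + 1 by ring, b₁, hs]; rfl,
        by rw [show 4 * a + 5 + 1 = 4 * (a + 1) + 2 by ring, b₂, hs]; rfl⟩
    · exact ⟨3, by omega, by omega, by rw [a₃, ha],
        by rw [show 4 * a + 3 + 1 = 4 * (a + 1) by ring, b₀, hs]⟩

/-- A good prefix followed by a Thue–Morse factor ending in `11` is a cubefree word of the form
`00x11`. -/
theorem IsGoodPrefix.exists_cubefree {p : List Bool} (hp : IsGoodPrefix p) {r : ℕ} (hr : 3 ≤ r)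
    (h₁ : thueMorse r = true) (h₂ : thueMorse (r + 1) = true) :
    ∃ x : List Bool, [false, false] ++ x ++ [true, true] =
        p ++ (List.range (r - 1)).map (fun n => thueMorse (n + 3)) ∧
      Cubefree ([false, false] ++ x ++ [true, true]) := by
  obtain ⟨h_start, h_last, hcheck⟩ := hp
  obtain ⟨s, rfl⟩ := Nat.exists_eq_add_of_le hr
  have hx : [false, false] ++ (p.drop 2 ++ (List.range s).map (fun n => thueMorse (n + 3))) ++
      [true, true] = p ++ (List.range (3 + s - 1)).map (fun n => thueMorse (n + 3)) := by
    rw [show 3 + s - 1 = s + 1 + 1 by omega, List.range_succ, List.range_succ, ← h_start]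
    simp only [← List.append_assoc, List.take_append_drop, List.map_append, List.map_cons,
      List.map_nil]
    rw [show s + 1 + 3 = 3 + s + 1 by omega, show s + 3 = 3 + s by omega, h₁, h₂]
    simp only [List.append_assoc, List.cons_append, List.nil_append]
  refine ⟨_, hx, hx ▸ cubefree_of_forall_not_cubeAt (W := prependTM p) (fun n hn => ?_)
    fun i q hq _ => not_cubeAt_prependTM h_last hcheck i q hq⟩
  rw [List.getElem_append]
  split_ifs with h
  · exact (prependTM_of_lt h).symm
  · simp [prependTM, h]

theorem exists_pair_of_fifteen_le {k : ℕ} (hk : 15 ≤ k) :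
    ∃ x y : List Bool, x ≠ y ∧
      ([false, false] ++ x ++ [true, true]).length = k ∧
      ([false, false] ++ y ++ [true, true]).length = k ∧
      Cubefree ([false, false] ++ x ++ [true, true]) ∧
      Cubefree ([false, false] ++ y ++ [true, true]) := by
  obtain ⟨e, he₁, he₂, h₁, h₂⟩ := exists_thueMorse_true_true ((k - 11) / 4)
  obtain ⟨p, q, hpq, hp, hq, gp, gq⟩ :=
    exists_two_isGoodPrefix (n := (k - 11) % 4 + 12 - e) (by omega) (by omega)
  obtain ⟨x, hx, cx⟩ := gp.exists_cubefree (by omega) h₁ h₂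
  obtain ⟨y, hy, cy⟩ := gq.exists_cubefree (by omega) h₁ h₂
  refine ⟨x, y, ?_, ?_, ?_, cx, cy⟩
  · rintro rfl
    exact hpq (List.append_cancel_right (hx.symm.trans hy))
  · rw [hx, List.length_append, List.length_map, List.length_range]
    omega
  · rw [hy, List.length_append, List.length_map, List.length_range]
    omega

theorem cubefree_of_forall_lt {w : List Bool}
    (h : ∀ i < w.length, ∀ q < w.length, 0 < q → i + 3 * q ≤ w.length →
      ¬ CubeAt (fun n => w.getD n false) i q) : Cubefree w :=
  cubefree_of_forall_not_cubeAt (W := fun n => w.getD n false) (fun n hn => by simp [hn])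
    fun i q hq hiq => h i (by omega) q (by omega) hq hiq

theorem stmt4 (k : ℕ) (hk : 9 ≤ k) :
    ∃ x y : List Bool, x ≠ y ∧
      ([false, false] ++ x ++ [true, true]).length = k ∧
      ([false, false] ++ y ++ [true, true]).length = k ∧
      Cubefree ([false, false] ++ x ++ [true, true]) ∧
      Cubefree ([false, false] ++ y ++ [true, true]) := by
  rcases le_or_gt 15 k with h | h
  · exact exists_pair_of_fifteen_le h
  interval_cases k
  · exact ⟨[true, false, false, true, false],
      [true, false, true, false, false],
      by decide, rfl, rfl, cubefree_of_forall_lt (by decide +kernel),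
      cubefree_of_forall_lt (by decide +kernel)⟩
  · exact ⟨[true, false, false, true, true, false],
      [true, false, true, true, false, false],
      by decide, rfl, rfl, cubefree_of_forall_lt (by decide +kernel),
      cubefree_of_forall_lt (by decide +kernel)⟩
  · exact ⟨[true, false, false, true, true, false, false],
      [true, false, true, false, false, true, false],
      by decide, rfl, rfl, cubefree_of_forall_lt (by decide +kernel),
      cubefree_of_forall_lt (by decide +kernel)⟩
  · exact ⟨[true, false, false, true, false, true, false, false],
      [true, false, false, true, false, true, true, false],
      by decide, rfl, rfl, cubefree_of_forall_lt (by decide +kernel),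
      cubefree_of_forall_lt (by decide +kernel)⟩
  · exact ⟨[true, false, false, true, false, true, true, false, false],
      [true, false, false, true, true, false, false, true, false],
      by decide, rfl, rfl, cubefree_of_forall_lt (by decide +kernel),
      cubefree_of_forall_lt (by decide +kernel)⟩
  · exact ⟨[true, false, false, true, false, true, false, false, true, false],
      [true, false, false, true, false, true, true, false, true, false],
      by decide, rfl, rfl, cubefree_of_forall_lt (by decide +kernel),
      cubefree_of_forall_lt (by decide +kernel)⟩
end

section
/- For every integer k ≥ 0, there exists a k-uniform cubefree binary morphism, i.e., a morphism h : {0,1}* → {0,1}* with |h(0)| = |h(1)| = k such that h(w) is cubefree for every cubefree word w. -/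
/-- `f` has a cube of period `p` at position `s`. -/
def HasCubeAt (f : ℕ → Bool) (s p : ℕ) : Prop :=
  ∀ i < 2 * p, f (s + i) = f (s + i + p)

/-- The letter at position `i` of `w`. -/
def letterAt (w : List Bool) (i : ℕ) : Bool := w.getD i false

/-- The image of the sequence `u` under the `k`-uniform morphism `a ↦ H a 0, …, H a (k - 1)`. -/
def blockSeq (H : Bool → ℕ → Bool) (k : ℕ) (u : ℕ → Bool) (i : ℕ) : Bool :=
  H (u (i / k)) (i % k)

/-- The word consisting of the first `k` letters of `f`. -/
def prefixWord (f : ℕ → Bool) (k : ℕ) : List Bool := (List.range k).map f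

lemma length_prefixWord (f : ℕ → Bool) (k : ℕ) : (prefixWord f k).length = k := by
  simp [prefixWord]

lemma letterAt_prefixWord (f : ℕ → Bool) {i k : ℕ} (hi : i < k) :
    letterAt (prefixWord f k) i = f i := by
  simp [letterAt, prefixWord, hi]

lemma letterAt_eq_getElem (w : List Bool) {i : ℕ} (hi : i < w.length) :
    letterAt w i = w[i] := by
  simp [letterAt, hi]

lemma cubefree_iff (w : List Bool) :
    Cubefree w ↔ ∀ s p, 0 < p → s + 3 * p ≤ w.length → ¬ HasCubeAt (letterAt w) s p := by
  constructor
  · intro hw s p hp hs hc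
    have key : ∀ i < 2 * p, w[s + i]? = w[s + i + p]? := by
      intro i hi
      have := hc i hi
      rw [letterAt_eq_getElem w (by omega), letterAt_eq_getElem w (by omega)] at this
      rw [List.getElem?_eq_getElem (by omega), List.getElem?_eq_getElem (by omega), this]
    set x := (w.drop s).take p with hx
    have hlen : x.length = p := by simp [hx]; omega
    refine hw x (by rintro h; simp [h] at hlen; omega) ⟨w.take s, w.drop (s + 3 * p), ?_⟩
    have e1 : (w.drop (s + p)).take p = x := by
      apply List.ext_getElem?
      intro i
      by_cases hi : i < p
      · simp only [hx, List.getElem?_take, hi, if_true, List.getElem?_drop]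
        rw [key i (by omega)]; congr 1; omega
      · simp [hx, hi]
    have e2 : (w.drop (s + p + p)).take p = x := by
      rw [← e1]
      apply List.ext_getElem?
      intro i
      by_cases hi : i < p
      · simp only [List.getElem?_take, hi, if_true, List.getElem?_drop]
        have := key (p + i) (by omega)
        rw [show s + p + i = s + (p + i) by omega, this]; congr 1; omega
      · simp [hi]
    have d0 : w.drop s = x ++ w.drop (s + p) := by
      rw [hx, ← List.drop_drop, List.take_append_drop]
    have d1 : w.drop (s + p) = x ++ w.drop (s + p + p) := by
      rw [← e1, ← List.drop_drop (i := p) (j := s + p), List.take_append_drop]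
    have d2 : w.drop (s + p + p) = x ++ w.drop (s + p + p + p) := by
      rw [← e2, ← List.drop_drop (i := p) (j := s + p + p), List.take_append_drop]
    have : w.drop s = x ++ x ++ x ++ w.drop (s + 3 * p) := by
      rw [d0, d1, d2, show s + p + p + p = s + 3 * p by ring]; simp
    conv_rhs => rw [← List.take_append_drop s w, this]
    simp
  · rintro hw x hx ⟨a, b, rfl⟩
    have hp : 0 < x.length := List.length_pos_iff.2 hx
    refine hw a.length x.length hp (by simp; omega) ?_
    intro i hi
    simp only [letterAt, List.getD_eq_getElem?_getD]
    congr 1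
    by_cases h : i < x.length
    · simp [List.getElem?_append, h, Nat.add_assoc]
    · simp [List.getElem?_append, h, Nat.add_assoc]
      grind

lemma length_flatMap_uniform {h : Bool → List Bool} {k : ℕ} (hk : ∀ a, (h a).length = k)
    (w : List Bool) : (w.flatMap h).length = k * w.length := by
  induction w with
  | nil => simp
  | cons a w ih => simp [ih, hk]; ring

lemma letterAt_flatMap {h : Bool → List Bool} {k : ℕ} (hk : ∀ a, (h a).length = k)
    (w : List Bool) {i : ℕ} (hi : i < k * w.length) :
    letterAt (w.flatMap h) i = blockSeq (fun a => letterAt (h a)) k (letterAt w) i := by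
  induction w generalizing i with
  | nil => simp at hi
  | cons a w ih =>
    have hk0 : 0 < k := by
      rcases Nat.eq_zero_or_pos k with rfl | h
      · simp at hi
      · exact h
    by_cases h1 : i < k
    · have : i / k = 0 := Nat.div_eq_of_lt h1
      simp [letterAt, blockSeq, this, Nat.mod_eq_of_lt h1, List.getElem?_append, hk, h1]
    · obtain ⟨j, rfl⟩ : ∃ j, i = j + k := ⟨i - k, by omega⟩
      have hj : j < k * w.length := by
        simp only [List.length_cons] at hi; nlinarith
      have := ih hj
      simp only [letterAt, blockSeq, List.getD_eq_getElem?_getD] at this ⊢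
      simp [List.getElem?_append, hk, hk0, this]

/-- A uniform morphism is cubefree as soon as the periods of the cubes in images of cubefree
words are multiples of the length of the morphism. -/
theorem cubefreeMorphism_of_dvd {H : Bool → ℕ → Bool} {k : ℕ}
    (hne : ∃ d < k, H false d ≠ H true d)
    (hdvd : ∀ w, Cubefree w → ∀ s p, 0 < p → s + 3 * p ≤ k * w.length →
      HasCubeAt (blockSeq H k (letterAt w)) s p → k ∣ p) :
    CubefreeMorphism (fun a => prefixWord (H a) k) := by
  intro w hw
  obtain ⟨d, hd, hne⟩ := hne
  have hk : ∀ a, (prefixWord (H a) k).length = k := fun a => length_prefixWord _ _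
  rw [cubefree_iff]
  intro s p hp hs hc
  rw [length_flatMap_uniform hk] at hs
  have hlet : ∀ i < k * w.length, letterAt (w.flatMap fun a => prefixWord (H a) k) i =
      blockSeq H k (letterAt w) i := by
    intro i hi
    rw [letterAt_flatMap hk w hi]
    exact letterAt_prefixWord _ (Nat.mod_lt _ (by omega))
  have hc' : HasCubeAt (blockSeq H k (letterAt w)) s p := by
    intro i hi
    rw [← hlet _ (by omega), ← hlet _ (by omega)]
    exact hc i hi
  obtain ⟨q, rfl⟩ := hdvd w hw s p hp hs hc'
  have hq : 0 < q := Nat.pos_of_mul_pos_left hp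
  obtain ⟨j, hj1, hj2⟩ : ∃ j, s ≤ k * j + d ∧ k * j + d < s + k := by
    have := Nat.div_add_mod s k
    have := Nat.mod_lt s (show 0 < k by omega)
    by_cases h : s % k ≤ d
    · exact ⟨s / k, by omega, by omega⟩
    · exact ⟨s / k + 1, by rw [mul_add]; omega, by rw [mul_add]; omega⟩
  have hN : j + 3 * q ≤ w.length := by
    have : k * (j + 3 * q) < k * (w.length + 1) := by nlinarith
    have := Nat.lt_of_mul_lt_mul_left this
    omega
  refine (cubefree_iff w).1 hw j q hq hN ?_
  intro i hi
  have hi' : k * (i + 1) ≤ k * (2 * q) := Nat.mul_le_mul_left k hi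
  have hb : ∀ m, blockSeq H k (letterAt w) (k * m + d) = H (letterAt w m) d := by
    intro m
    have : (k * m + d) / k = m := by
      rw [Nat.mul_add_div (by omega), Nat.div_eq_of_lt hd]; rfl
    rw [blockSeq, this, Nat.mul_add_mod, Nat.mod_eq_of_lt hd]
  have := hc' (k * j + d + k * i - s) (by
    nlinarith [Nat.sub_add_cancel (show s ≤ k * j + d + k * i by omega)])
  rw [show s + (k * j + d + k * i - s) = k * (j + i) + d by rw [mul_add]; omega,
    show k * (j + i) + d + k * q = k * (j + i + q) + d by ring, hb, hb] at this
  generalize letterAt w (j + i) = a at *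
  generalize letterAt w (j + i + q) = b at *
  cases a <;> cases b <;> simp_all

/-- All words of length `n`. -/
def words : ℕ → List (List Bool)
  | 0 => [[]]
  | n + 1 => (words n).flatMap fun w => [false :: w, true :: w]

lemma mem_words (w : List Bool) : w ∈ words w.length := by
  induction w with
  | nil => simp [words]
  | cons a w ih =>
    simp only [List.length_cons, words, List.mem_flatMap]
    exact ⟨w, ih, by cases a <;> simp⟩

/-- A decidable form of cubefreeness. -/
abbrev NoCube (w : List Bool) : Prop :=
  ∀ s < w.length, ∀ p < w.length + 1, 0 < p → s + 3 * p ≤ w.length →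
    ∃ i < 2 * p, letterAt w (s + i) ≠ letterAt w (s + i + p)

lemma Cubefree.noCube {w : List Bool} (hw : Cubefree w) : NoCube w := by
  intro s _ p _ hp hs
  have := (cubefree_iff w).1 hw s p hp hs
  simpa [HasCubeAt] using this

/-- The factors of length `l` occurring at positions congruent to `i` modulo `k` in images of
cubefree words. -/
def factorsAt (H : Bool → ℕ → Bool) (k l i : ℕ) : List (List Bool) :=
  ((words ((i + l - 1) / k + 1)).filter fun w => NoCube w).map fun w =>
    prefixWord (fun j => blockSeq H k (letterAt w) (i + j)) l

lemma mem_factorsAt (H : Bool → ℕ → Bool) {k l s : ℕ} (hl : 0 < l) {w : List Bool}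
    (hw : Cubefree w) (hs : s + l ≤ k * w.length) :
    prefixWord (fun j => blockSeq H k (letterAt w) (s + j)) l ∈ factorsAt H k l (s % k) := by
  have hk : 0 < k := by
    rcases Nat.eq_zero_or_pos k with rfl | h
    · simp at hs; omega
    · exact h
  have hsk := Nat.div_add_mod s k
  set r := (s % k + l - 1) / k + 1 with hr
  have hrw : s / k + r ≤ w.length := by
    have h1 : k * (s / k + (s % k + l - 1) / k) < k * w.length := by
      have := Nat.mul_div_le (s % k + l - 1) k
      rw [mul_add]; omega
    have := Nat.lt_of_mul_lt_mul_left h1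
    omega
  set v := prefixWord (fun j => letterAt w (s / k + j)) r with hv
  have hvl : v.length = r := length_prefixWord _ _
  have hlet : ∀ i < r, letterAt v i = letterAt w (s / k + i) := fun i hi =>
    letterAt_prefixWord _ hi
  have hvc : Cubefree v := by
    rw [cubefree_iff]
    intro t p hp ht hc
    rw [hvl] at ht
    refine (cubefree_iff w).1 hw (s / k + t) p hp (by omega) fun i hi => ?_
    have := hc i hi
    rw [hlet _ (by omega), hlet _ (by omega)] at this
    rw [show s / k + t + i = s / k + (t + i) by ring, this]
    congr 1; ring
  refine List.mem_map.2 ⟨v, List.mem_filter.2 ⟨?_, by simpa using hvc.noCube⟩, ?_⟩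
  · rw [← hr, ← hvl]; exact mem_words v
  · refine List.map_congr_left fun j hj => ?_
    have hj' : j < l := List.mem_range.1 hj
    have hlt : (s % k + j) / k < r := by
      have : (s % k + j) / k ≤ (s % k + l - 1) / k := Nat.div_le_div_right (by omega)
      omega
    have e : s + j = k * (s / k) + (s % k + j) := by omega
    simp only [blockSeq]
    rw [hlet _ hlt, e, Nat.mul_add_div hk, Nat.mul_add_mod]

/-- A decidable criterion: factors of length `l` of images of cubefree words determine their
position modulo `k`, and these images contain no cubes of period less than `l`. -/
abbrev Synchronizing (H : Bool → ℕ → Bool) (k l : ℕ) : Prop :=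
  0 < l ∧ (∀ i < k, ∀ j < k, ∀ f ∈ factorsAt H k l i, f ∈ factorsAt H k l j → i = j) ∧
    (∀ p < l, 0 < p → ∀ i < k, ∀ f ∈ factorsAt H k (3 * p) i, f.take (2 * p) ≠ f.drop p) ∧
    ¬ ∀ d < k, H false d = H true d

set_option synthInstance.maxSize 1000 in
instance (H : Bool → ℕ → Bool) (k l : ℕ) : Decidable (Synchronizing H k l) :=
  inferInstance

theorem Synchronizing.cubefreeMorphism {H : Bool → ℕ → Bool} {k l : ℕ}
    (h : Synchronizing H k l) : CubefreeMorphism (fun a => prefixWord (H a) k) := by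
  obtain ⟨hl, hsync, hshort, hne⟩ := h
  push Not at hne
  refine cubefreeMorphism_of_dvd hne fun w hw s p hp hs hc => ?_
  have hk : 0 < k := by obtain ⟨d, hd, -⟩ := hne; omega
  have hpl : l ≤ p := by
    by_contra hlt
    refine hshort p (by omega) hp (s % k) (Nat.mod_lt _ hk) _
      (mem_factorsAt H (by omega) hw hs) ?_
    apply List.ext_getElem
    · simp [prefixWord]; omega
    · intro i h1 h2
      simp only [List.length_take, length_prefixWord] at h1
      have := hc i (by omega)
      simpa [prefixWord, add_assoc, add_comm, add_left_comm] using this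
  have h1 := mem_factorsAt H (k := k) hl hw (s := s) (by omega)
  have h2 := mem_factorsAt H (k := k) hl hw (s := s + p) (by omega)
  have heq : prefixWord (fun j => blockSeq H k (letterAt w) (s + p + j)) l =
      prefixWord (fun j => blockSeq H k (letterAt w) (s + j)) l := by
    refine List.map_congr_left fun j hj => ?_
    have hj' : j < l := List.mem_range.1 hj
    rw [hc j (by omega)]
    congr 1; ring
  rw [heq] at h2
  by_contra hdvd
  have hmod := hsync _ (Nat.mod_lt s hk) _ (Nat.mod_lt (s + p) hk) _ h1 h2
  apply hdvd
  have := (Nat.modEq_iff_dvd' (show s ≤ s + p by omega)).1 hmod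
  simpa using this

/-- The first two blocks of `blockSeq H k u` when `u` starts with `a, b`. -/
def twoBlocks (H : Bool → ℕ → Bool) (k : ℕ) (a b : Bool) (i : ℕ) : Bool :=
  if i < k then H a i else H b (i - k)

lemma blockSeq_eq_twoBlocks (H : Bool → ℕ → Bool) (k : ℕ) (u : ℕ → Bool) (j : ℕ) {i : ℕ}
    (hi : i < 2 * k) :
    blockSeq H k u (k * j + i) = twoBlocks H k (u j) (u (j + 1)) i := by
  unfold blockSeq twoBlocks
  have hk : 0 < k := by omega
  rw [Nat.mul_add_div hk, Nat.mul_add_mod]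
  split_ifs with h
  · rw [Nat.div_eq_of_lt h, Nat.mod_eq_of_lt h]; rfl
  · obtain ⟨m, rfl⟩ : ∃ m, i = m + k := ⟨i - k, by omega⟩
    have hm : m < k := by omega
    rw [Nat.add_div_right _ hk, Nat.div_eq_of_lt hm, Nat.add_mod_right, Nat.mod_eq_of_lt hm]
    simp

/-- If every block contains a marker `m` of length `l` at offset `c`, if the marker occurs nowhere
else, and if pairs of blocks contain no short cubes and no cubes avoiding the marker, then all
periods of cubes are multiples of `k`. -/
theorem dvd_of_hasCubeAt_of_marker {H : Bool → ℕ → Bool} {k c l : ℕ} {m : ℕ → Bool}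
    (hcl : c + l ≤ k) (hl : 3 * l ≤ k + 4) (hl0 : 0 < l)
    (hocc : ∀ a, ∀ j < l, H a (c + j) = m j)
    (huniq : ∀ a b, ∀ i < k, (∀ j < l, twoBlocks H k a b (i + j) = m j) → i = c)
    (hfree : ∀ a b s p, 0 < p → s < k → s + 3 * p ≤ 2 * k →
      (p < l ∨ (c < s ∧ s + 3 * p < k + c + l) ∨ s + 3 * p < c + l) →
      ¬ HasCubeAt (twoBlocks H k a b) s p)
    {u : ℕ → Bool} {s p : ℕ} (hp : 0 < p) (hc : HasCubeAt (blockSeq H k u) s p) : k ∣ p := by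
  have hk : 0 < k := by omega
  have hsk := Nat.div_add_mod s k
  have hsm := Nat.mod_lt s hk
  have free : s % k + 3 * p ≤ 2 * k →
      (p < l ∨ (c < s % k ∧ s % k + 3 * p < k + c + l) ∨ s % k + 3 * p < c + l) → False := by
    intro h1 h2
    refine hfree (u (s / k)) (u (s / k + 1)) _ p hp hsm h1 h2 fun i hi => ?_
    rw [← blockSeq_eq_twoBlocks H k u _ (by omega), ← blockSeq_eq_twoBlocks H k u _ (by omega)]
    have := hc i hi
    rw [← hsk] at this
    simpa only [add_assoc] using this
  by_cases hpl : p < l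
  · exact (free (by omega) (Or.inl hpl)).elim
  have occ : ∀ q, ∀ j < l, blockSeq H k u (k * q + c + j) = m j := by
    intro q j hj
    rw [add_assoc, blockSeq_eq_twoBlocks H k u q (by omega), twoBlocks, if_pos (by omega)]
    exact hocc _ j hj
  have uniq : ∀ i, (∀ j < l, blockSeq H k u (i + j) = m j) → i % k = c := by
    intro i hi
    have hik := Nat.div_add_mod i k
    have him := Nat.mod_lt i hk
    refine huniq (u (i / k)) (u (i / k + 1)) _ him fun j hj => ?_
    rw [← blockSeq_eq_twoBlocks H k u _ (by omega), ← hi j hj, ← add_assoc, hik]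
  obtain ⟨q, hq1, hq2⟩ : ∃ q, s ≤ k * q + c ∧
      (q = s / k ∧ s % k ≤ c ∨ q = s / k + 1 ∧ c < s % k) := by
    by_cases h : s % k ≤ c
    · exact ⟨s / k, by omega, Or.inl ⟨rfl, h⟩⟩
    · exact ⟨s / k + 1, by rw [mul_add]; omega, Or.inr ⟨rfl, by omega⟩⟩
  have hmod : (k * q + c) % k = c := by
    rw [Nat.mul_add_mod, Nat.mod_eq_of_lt (by omega)]
  by_cases hin : k * q + c + l ≤ s + 3 * p
  · by_cases hright : k * q + c + l + p ≤ s + 3 * p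
    · have := uniq (k * q + c + p) fun j hj => by
        rw [← occ q j hj]
        have := hc (k * q + c + j - s) (by omega)
        rw [show s + (k * q + c + j - s) = k * q + c + j by omega] at this
        rw [this]; congr 1; ring
      have := (Nat.modEq_iff_dvd' (show k * q + c ≤ k * q + c + p by omega)).1
        (hmod.trans this.symm)
      simpa using this
    · have := uniq (k * q + c - p) fun j hj => by
        rw [← occ q j hj]
        have := hc (k * q + c - p + j - s) (by omega)
        rw [show s + (k * q + c - p + j - s) = k * q + c - p + j by omega] at this
        rw [this]; congr 1; omega
      have := (Nat.modEq_iff_dvd' (show k * q + c - p ≤ k * q + c by omega)).1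
        (this.trans hmod.symm)
      rwa [show k * q + c - (k * q + c - p) = p by omega] at this
  · exfalso
    rcases hq2 with ⟨rfl, h⟩ | ⟨rfl, h⟩
    · exact free (by omega) (Or.inr (Or.inr (by omega)))
    · rw [mul_add] at hin
      exact free (by omega) (Or.inr (Or.inl ⟨h, by omega⟩))

/-- The Thue–Morse sequence. -/
def tm (n : ℕ) : Bool :=
  if h : n = 0 then false else (tm (n / 2)) ^^ (n % 2 == 1)
decreasing_by omega

lemma tm_zero : tm 0 = false := by
  rw [tm]; simp

lemma tm_eq (n : ℕ) : tm n = ((tm (n / 2)) ^^ (n % 2 == 1)) := by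
  rw [tm]
  split_ifs with h
  · subst h; simp [tm_zero]
  · rfl

lemma tm_two_mul (n : ℕ) : tm (2 * n) = tm n := by
  rw [tm_eq]; simp

lemma tm_two_mul_add_one (n : ℕ) : tm (2 * n + 1) = !tm n := by
  rw [tm_eq, show (2 * n + 1) / 2 = n by omega]; simp

lemma not_tm_eq_eq (s : ℕ) : ¬ (tm s = tm (s + 1) ∧ tm (s + 1) = tm (s + 2)) := by
  rintro ⟨h1, h2⟩
  rcases Nat.even_or_odd' s with ⟨j, rfl | rfl⟩
  · rw [tm_two_mul, tm_two_mul_add_one] at h1; simp at h1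
  · rw [show 2 * j + 1 + 1 = 2 * (j + 1) by ring, show 2 * j + 1 + 2 = 2 * (j + 1) + 1 by ring,
      tm_two_mul, tm_two_mul_add_one] at h2
    simp at h2

lemma odd_of_tm_eq_succ {s : ℕ} (h : tm s = tm (s + 1)) : s % 2 = 1 := by
  rcases Nat.even_or_odd' s with ⟨j, rfl | rfl⟩
  · rw [tm_two_mul, tm_two_mul_add_one] at h; simp at h
  · omega

lemma exists_tm_eq_succ (s : ℕ) : ∃ i < 4, tm (s + i) = tm (s + i + 1) := by
  by_contra! h
  have h0 := h 0 (by omega)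
  have h1 := h 1 (by omega)
  have h2 := h 2 (by omega)
  have h3 := h 3 (by omega)
  simp only [add_zero, add_assoc, Nat.reduceAdd] at h0 h1 h2 h3
  have e1 : tm s = tm (s + 2) := by
    revert h0 h1; cases tm s <;> cases tm (s + 1) <;> cases tm (s + 2) <;> simp
  have e2 : tm (s + 2) = tm (s + 4) := by
    revert h2 h3; cases tm (s + 2) <;> cases tm (s + 3) <;> cases tm (s + 4) <;> simp
  rcases Nat.even_or_odd' s with ⟨j, rfl | rfl⟩
  · refine not_tm_eq_eq j ⟨?_, ?_⟩
    · simpa only [← mul_add_one, tm_two_mul] using e1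
    · simpa only [← mul_add_one, tm_two_mul, show 2 * j + 4 = 2 * (j + 2) by ring] using e2
  · refine not_tm_eq_eq j ⟨?_, ?_⟩
    · rw [show 2 * j + 1 + 2 = 2 * (j + 1) + 1 by ring] at e1
      simpa only [tm_two_mul_add_one, Bool.not_inj_iff] using e1
    · rw [show 2 * j + 1 + 2 = 2 * (j + 1) + 1 by ring,
        show 2 * j + 1 + 4 = 2 * (j + 2) + 1 by ring] at e2
      simpa only [tm_two_mul_add_one, Bool.not_inj_iff] using e2

/-- The Thue–Morse sequence is overlap-free. -/
theorem tm_overlapFree {p : ℕ} (hp : 0 < p) (s : ℕ) :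
    ¬ ∀ i ≤ p, tm (s + i) = tm (s + i + p) := by
  induction p using Nat.strong_induction_on generalizing s with
  | _ p ih =>
  intro h
  rcases Nat.even_or_odd' p with ⟨q, rfl | rfl⟩
  · refine ih q (by omega) (by omega) (s / 2) fun i hi => ?_
    have := h (2 * i) (by omega)
    rcases Nat.even_or_odd' s with ⟨j, rfl | rfl⟩
    · rw [show 2 * j + 2 * i = 2 * (j + i) by ring, ← mul_add, tm_two_mul, tm_two_mul] at this
      simpa using this
    · rw [show 2 * j + 1 + 2 * i = 2 * (j + i) + 1 by ring,
        show 2 * (j + i) + 1 + 2 * q = 2 * (j + i + q) + 1 by ring,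
        tm_two_mul_add_one, tm_two_mul_add_one] at this
      rw [show (2 * j + 1) / 2 = j by omega]
      simpa using this
  · have hno : ∀ i, i + 1 ≤ 2 * q + 1 → tm (s + i) ≠ tm (s + i + 1) := by
      intro i hi he
      have h1 := odd_of_tm_eq_succ he
      have h2 : tm (s + i + (2 * q + 1)) = tm (s + i + (2 * q + 1) + 1) := by
        have a := h i (by omega)
        have b := h (i + 1) hi
        rw [← a, he, ← add_assoc] at *
        rw [b]; congr 1; ring
      have := odd_of_tm_eq_succ h2
      omega
    rcases lt_or_ge q 2 with hq | hq
    · interval_cases q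
      · exact not_tm_eq_eq s ⟨h 0 (by omega), h 1 (by omega)⟩
      · have h0 := hno 0 (by omega)
        have h1 := hno 1 (by omega)
        have h2 := hno 2 (by omega)
        have h3 := h 0 (by omega)
        simp only [add_zero, add_assoc, Nat.reduceAdd, Nat.reduceMul] at h0 h1 h2 h3
        revert h0 h1 h2 h3
        cases tm s <;> cases tm (s + 1) <;> cases tm (s + 2) <;> cases tm (s + 3) <;> simp
    · obtain ⟨i, hi, he⟩ := exists_tm_eq_succ s
      exact hno i (by omega) he

/-- The bits of this number are the first 64 letters of the Thue–Morse sequence. -/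
def tmBits : ℕ := 7608434000728254870

lemma tm_eq_testBit {r : ℕ} (hr : r < 64) : tm r = tmBits.testBit r := by
  induction r using Nat.strong_induction_on with
  | _ r ih =>
  rcases Nat.eq_zero_or_pos r with rfl | h0
  · simp [tm_zero, tmBits]
  · rw [tm_eq, ih (r / 2) (by omega) (by omega)]
    have : ∀ r < 64, (tmBits.testBit (r / 2) ^^ (r % 2 == 1)) = tmBits.testBit r := by
      decide +kernel
    exact this r hr

lemma tm_two_pow_mul_add (e q : ℕ) {r : ℕ} (hr : r < 2 ^ e) :
    tm (2 ^ e * q + r) = (tm q ^^ tm r) := by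
  induction e generalizing r with
  | zero =>
    obtain rfl : r = 0 := by simpa using hr
    simp [tm_zero]
  | succ e ih =>
    rw [pow_succ] at hr ⊢
    have := ih (r := r / 2) (by omega)
    rw [tm_eq, tm_eq r, show (2 ^ e * 2 * q + r) / 2 = 2 ^ e * q + r / 2 by
      rw [show 2 ^ e * 2 * q = 2 * (2 ^ e * q) by ring]; omega, this,
      show (2 ^ e * 2 * q + r) % 2 = r % 2 by
        rw [show 2 ^ e * 2 * q = 2 * (2 ^ e * q) by ring]; omega]
    simp

/-- The bits of this number are 64 consecutive letters of the Thue–Morse sequence, starting at a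
position `64 * q` with `tm q = b`. -/
def tmBlock (b : Bool) : ℕ := if b then 10838310072981296745 else tmBits

lemma tm_eq_testBit_tmBlock (q : ℕ) {r : ℕ} (hr : r < 64) :
    tm (64 * q + r) = (tmBlock (tm q)).testBit r := by
  rw [show 64 = 2 ^ 6 by norm_num, tm_two_pow_mul_add 6 q (by omega), tm_eq_testBit hr]
  have : ∀ b, ∀ r < 64, (b ^^ tmBits.testBit r) = (tmBlock b).testBit r := by decide +kernel
  exact this _ r hr

/-- The number whose bits are the first `k` bits of `a` followed by those of `b`. -/
def pack (a k b : ℕ) : ℕ := a % 2 ^ k ||| b <<< k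

lemma testBit_pack (a k b i : ℕ) :
    (pack a k b).testBit i = if i < k then a.testBit i else b.testBit (i - k) := by
  unfold pack
  rw [Nat.testBit_or, Nat.testBit_mod_two_pow, Nat.testBit_shiftLeft]
  split_ifs with h
  · simp [h, Nat.not_le.2 h]
  · simp [h, Nat.not_lt.1 h]

/-- Bit `i` of this number is the disjunction of the bits `i, …, i + n - 1` of `d`. -/
def orFold (d : ℕ) : ℕ → ℕ
  | 0 => 0
  | n + 1 => d ||| orFold d n >>> 1

lemma testBit_orFold (d n i : ℕ) :
    (orFold d n).testBit i = true ↔ ∃ j < n, d.testBit (i + j) = true := by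
  induction n generalizing i with
  | zero => simp [orFold]
  | succ n ih =>
    rw [orFold, Nat.testBit_or, Bool.or_eq_true, Nat.testBit_shiftRight, ih]
    constructor
    · rintro (h | ⟨j, hj, h⟩)
      · exact ⟨0, by omega, h⟩
      · exact ⟨j + 1, by omega, by rwa [show i + (j + 1) = 1 + i + j by ring]⟩
    · rintro ⟨j, hj, h⟩
      rcases j with _ | j
      · exact Or.inl h
      · exact Or.inr ⟨j, by omega, by rwa [show 1 + i + j = i + (j + 1) by ring]⟩

/-- The first `n` bits of `v` contain no cubes of period at most `q`. -/
abbrev NoCubeBits (v n q : ℕ) : Prop :=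
  ∀ p < q + 1, 0 < p → 3 * p ≤ n →
    orFold (v ^^^ v >>> p) (2 * p) % 2 ^ (n - 3 * p + 1) = 2 ^ (n - 3 * p + 1) - 1

lemma NoCubeBits.not_hasCubeAt {v n q s p : ℕ} (h : NoCubeBits v n q) (hp : 0 < p) (hpq : p ≤ q)
    (hs : s + 3 * p ≤ n) : ¬ HasCubeAt v.testBit s p := by
  intro hc
  have h1 := congrArg (fun x => x.testBit s) (h p (by omega) hp (by omega))
  simp only [Nat.testBit_mod_two_pow, Nat.testBit_two_pow_sub_one,
    show s < n - 3 * p + 1 by omega, decide_true, Bool.true_and] at h1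
  obtain ⟨j, hj, h2⟩ := (testBit_orFold _ _ _).1 h1
  rw [Nat.testBit_xor, Nat.testBit_shiftRight, hc j hj, show p + (s + j) = s + j + p by ring] at h2
  simp at h2

/-- Among the positions less than `n`, the word formed by the `l` low bits of `m` occurs in the
bits of `v` at most at position `c`. -/
abbrev OccursOnlyAt (m l v n c : ℕ) : Prop :=
  ∀ i < n, (v >>> i) % 2 ^ l = m % 2 ^ l → i = c

lemma shiftRight_mod_two_pow_eq {m l v i : ℕ} (h : ∀ j < l, v.testBit (i + j) = m.testBit j) :
    (v >>> i) % 2 ^ l = m % 2 ^ l := by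
  apply Nat.eq_of_testBit_eq
  intro j
  simp only [Nat.testBit_mod_two_pow, Nat.testBit_shiftRight]
  by_cases hj : j < l
  · simp [hj, h j hj]
  · simp [hj]

/-- A decidable form of the hypotheses of `dvd_of_hasCubeAt_of_marker`. -/
abbrev MarkerCriterion (B : Bool → ℕ) (k m c l : ℕ) : Prop :=
  c + l ≤ k ∧ 3 * l ≤ k + 4 ∧ 0 < l ∧ B false % 2 ^ k ≠ B true % 2 ^ k ∧
    ∀ a, (B a >>> c) % 2 ^ l = m % 2 ^ l ∧ ∀ b,
      NoCubeBits (pack (B a) k (B b)) (2 * k) (2 * k) ∧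
        OccursOnlyAt m l (pack (B a) k (B b)) k c

instance (B : Bool → ℕ) (k m c l : ℕ) : Decidable (MarkerCriterion B k m c l) :=
  inferInstance

theorem MarkerCriterion.cubefreeMorphism {B : Bool → ℕ} {k m c l : ℕ}
    (h : MarkerCriterion B k m c l) :
    CubefreeMorphism (fun a => prefixWord (B a).testBit k) := by
  obtain ⟨hcl, hl, hl0, hne, hB⟩ := h
  have htwo : ∀ a b, twoBlocks (fun a => (B a).testBit) k a b = (pack (B a) k (B b)).testBit := by
    intro a b
    funext i
    rw [testBit_pack]; rfl
  refine cubefreeMorphism_of_dvd (H := fun a => (B a).testBit) ?_ fun w _ s p hp _ hc =>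
    dvd_of_hasCubeAt_of_marker (m := m.testBit) hcl hl hl0 ?_ ?_ ?_ hp hc
  · by_contra! hno
    apply hne
    simpa using shiftRight_mod_two_pow_eq (i := 0) (v := B false) (m := B true) (l := k)
      fun j hj => by simpa using hno j hj
  · intro a j hj
    have := congrArg (fun x => x.testBit j) (hB a).1
    simpa [Nat.testBit_mod_two_pow, hj] using this
  · intro a b i hi hocc
    rw [htwo] at hocc
    exact ((hB a).2 b).2 i hi (shiftRight_mod_two_pow_eq hocc)
  · intro a b s p hp _ hs _
    rw [htwo]
    exact ((hB a).2 b).1.not_hasCubeAt hp (by omega) hs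

/-- Two distinct words of length 11, given by their bits, which contain a common marker of length
`2 * half + 1` at position `offset` when they are continued with the Thue–Morse sequence. -/
structure Border where
  word : Bool → ℕ
  marker : ℕ
  offset : ℕ
  half : ℕ

/-- The length of the marker. -/
abbrev Border.len (d : Border) : ℕ := 2 * d.half + 1

/-- The borders from which the uniform morphisms are built. -/
def borders : List Border :=
  [⟨fun a => if a then 729 else 1241, 54, 2, 3⟩, ⟨fun a => if a then 726 else 1238, 21, 2, 2⟩,
    ⟨fun a => if a then 1644 else 1612, 91, 9, 3⟩]

/-- The word with number `a` of the border `d`, preceded by the 48 low bits of `s` and followed by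
the Thue–Morse sequence. -/
abbrev Border.context (d : Border) (s : ℕ) (a : Bool) : ℕ :=
  pack s 48 (pack (d.word a) 11 tmBits)

/-- The border `d` can be put between a word with the bits of `s` and the Thue–Morse sequence. -/
abbrev Border.Compatible (d : Border) (s : ℕ) : Prop :=
  d.offset ≤ 10 ∧ d.half ≤ 3 ∧ 0 < d.half ∧ d.word false % 2 ^ 11 ≠ d.word true % 2 ^ 11 ∧
    (∀ j < d.half + 1, d.marker.testBit j = d.marker.testBit (j + d.half)) ∧
    ∀ a, NoCubeBits (d.context s a) 107 16 ∧
      OccursOnlyAt d.marker d.len (d.context s a) 100 (48 + d.offset) ∧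
      (d.context s a >>> (48 + d.offset)) % 2 ^ d.len = d.marker % 2 ^ d.len

lemma exists_compatible_border : ∀ b₁ b₂, ∀ r < 64, ∃ d ∈ borders,
    d.Compatible (pack (tmBlock b₁) 64 (tmBlock b₂) >>> r) := by
  decide +kernel

lemma exists_compatible_border_of_tm (n : ℕ) : ∃ (d : Border) (s : ℕ), d.Compatible s ∧
    ∀ j < 48, s.testBit j = tm (n + j) := by
  obtain ⟨d, -, hd⟩ := exists_compatible_border (tm (n / 64)) (tm (n / 64 + 1)) (n % 64)
    (Nat.mod_lt _ (by norm_num))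
  refine ⟨d, _, hd, fun j hj => ?_⟩
  rw [Nat.testBit_shiftRight, testBit_pack]
  split_ifs with h
  · rw [← tm_eq_testBit_tmBlock _ h]; congr 1; omega
  · rw [← tm_eq_testBit_tmBlock _ (by omega)]; congr 1; omega

/-- The sequence starting with a word of the border `d`, continued by the Thue–Morse sequence. -/
def Border.seq (d : Border) (a : Bool) (i : ℕ) : Bool :=
  if i < 11 then (d.word a).testBit i else tm (i - 11)

theorem Border.Compatible.cubefreeMorphism {d : Border} {s n : ℕ} (hn : 48 ≤ n)
    (hd : d.Compatible s) (hs : ∀ j < 48, s.testBit j = tm (n - 48 + j)) :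
    CubefreeMorphism (fun a => prefixWord (d.seq a) (n + 11)) := by
  obtain ⟨hc, hh, hh0, hne, hover, hctx⟩ := hd
  have hlen : d.len = 2 * d.half + 1 := rfl
  have ctx : ∀ a i, i < 107 → (d.context s a).testBit i =
      if i < 48 then tm (n - 48 + i) else d.seq a (i - 48) := by
    intro a i hi
    rw [testBit_pack, testBit_pack]
    split_ifs with h1 h2
    · exact hs i h1
    · rw [Border.seq, if_pos h2]
    · rw [Border.seq, if_neg h2, tm_eq_testBit (by omega)]
  have start : ∀ a b i, i < 59 →
      twoBlocks d.seq (n + 11) a b i = (d.context s a).testBit (48 + i) := by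
    intro a b i hi
    rw [ctx a _ (by omega), if_neg (by omega), twoBlocks, if_pos (by omega)]
    congr 1; omega
  have inner : ∀ a b i, 11 ≤ i → i < n + 11 →
      twoBlocks d.seq (n + 11) a b i = tm (i - 11) := by
    intro a b i h1 h2
    rw [twoBlocks, if_pos h2, Border.seq, if_neg (by omega)]
  have border : ∀ a b i, n - 37 ≤ i → i < n + 70 →
      twoBlocks d.seq (n + 11) a b i = (d.context s b).testBit (i - (n - 37)) := by
    intro a b i h1 h2
    rw [ctx b _ (by omega)]
    split_ifs with h
    · rw [inner a b i (by omega) (by omega)]; congr 1; omega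
    · rw [twoBlocks, if_neg (by omega)]; congr 1; omega
  have noOverlap : ∀ a b t p, 0 < p → 11 ≤ t → t + 2 * p < n + 11 →
      ¬ ∀ i ≤ p, twoBlocks d.seq (n + 11) a b (t + i) =
        twoBlocks d.seq (n + 11) a b (t + i + p) := by
    intro a b t p hp h1 h2 h
    refine tm_overlapFree hp (t - 11) fun i hi => ?_
    have := h i hi
    rw [inner _ _ _ (by omega) (by omega), inner _ _ _ (by omega) (by omega)] at this
    rw [show t - 11 + i = t + i - 11 by omega, this]
    congr 1; omega
  refine cubefreeMorphism_of_dvd ?_ fun w _ t p hp _ hcube =>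
    dvd_of_hasCubeAt_of_marker (c := d.offset) (l := d.len) (m := d.marker.testBit)
      (by omega) (by omega) (by omega) ?_ ?_ ?_ hp hcube
  · by_contra! hno
    apply hne
    simpa using shiftRight_mod_two_pow_eq (i := 0) (v := d.word false) (m := d.word true)
      (l := 11) fun j hj => by simpa [Border.seq, hj] using hno j (by omega)
  · intro a j hj
    have h1 := congrArg (fun x => x.testBit j) (hctx a).2.2
    simp only [Nat.testBit_mod_two_pow, Nat.testBit_shiftRight, hj, decide_true,
      Bool.true_and] at h1
    rw [← h1, ctx a _ (by omega), if_neg (by omega)]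
    congr 1; omega
  · intro a b i hi hocc
    by_cases hi1 : i < 11
    · have := (hctx a).2.1 (48 + i) (by omega) (shiftRight_mod_two_pow_eq fun j hj => by
        rw [← hocc j hj, start a b _ (by omega), add_assoc])
      omega
    by_cases hi2 : i + d.len ≤ n + 11
    · refine (noOverlap a b i d.half hh0 (by omega) (by omega) fun j hj => ?_).elim
      rw [hocc j (by omega), add_assoc, hocc _ (by omega)]
      exact hover j (by omega)
    · have := (hctx b).2.1 (i - (n - 37)) (by omega) (shiftRight_mod_two_pow_eq fun j hj => by
        rw [← hocc j hj, border a b _ (by omega) (by omega)]; congr 1; omega)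
      omega
  · intro a b t p hp ht htp hcase hcube
    by_cases hp16 : p ≤ 16
    · by_cases ht1 : t < 11
      · refine (hctx a).1.not_hasCubeAt hp hp16 (s := 48 + t) (by omega) fun i hi => ?_
        have := hcube i hi
        rw [start _ _ _ (by omega), start _ _ _ (by omega)] at this
        simpa only [add_assoc] using this
      by_cases ht2 : t + 3 * p ≤ n + 11
      · exact noOverlap a b t p hp (by omega) (by omega) fun i hi => hcube i (by omega)
      · refine (hctx b).1.not_hasCubeAt hp hp16 (s := t - (n - 37)) (by omega) fun i hi => ?_
        have := hcube i hi
        rw [border _ _ _ (by omega) (by omega), border _ _ _ (by omega) (by omega)] at this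
        rw [show t - (n - 37) + i = t + i - (n - 37) by omega, this]
        congr 1; omega
    · by_cases ht1 : t < 11
      · refine noOverlap a b 11 p hp le_rfl (by omega) fun i hi => ?_
        have := hcube (11 - t + i) (by omega)
        rwa [show t + (11 - t + i) = 11 + i by omega] at this
      · exact noOverlap a b t p hp (by omega) (by omega) fun i hi => hcube i (by omega)

/-- There is a cubefree morphism that is `k`-uniform. -/
def ExistsUniform (k : ℕ) : Prop :=
  ∃ h : Bool → List Bool, (h false).length = k ∧ (h true).length = k ∧ CubefreeMorphism h

lemma existsUniform_of_prefixWord {H : Bool → ℕ → Bool} {k : ℕ}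
    (h : CubefreeMorphism fun a => prefixWord (H a) k) : ExistsUniform k :=
  ⟨_, length_prefixWord _ _, length_prefixWord _ _, h⟩

lemma existsUniform_zero : ExistsUniform 0 :=
  ⟨fun _ => [], rfl, rfl, fun w _ x hx h => hx <| by
    rw [List.flatMap_eq_nil_iff.2 fun _ _ => rfl] at h
    simpa using List.infix_nil.1 h⟩

lemma existsUniform_one : ExistsUniform 1 :=
  ⟨fun a => [a], rfl, rfl, fun w hw => by simpa using hw⟩

/-- The two numbers `x` and `y`, indexed by letters. -/
abbrev bitPair (x y : ℕ) (a : Bool) : ℕ := if a then y else x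

lemma existsUniform_of_synchronizing {B : Bool → ℕ} {k l : ℕ}
    (h : Synchronizing (fun a => (B a).testBit) k l) : ExistsUniform k :=
  existsUniform_of_prefixWord h.cubefreeMorphism

lemma existsUniform_of_markerCriterion {B : Bool → ℕ} {k m c l : ℕ}
    (h : MarkerCriterion B k m c l) : ExistsUniform k :=
  existsUniform_of_prefixWord h.cubefreeMorphism

lemma exists_border_markerCriterion : ∀ k < 59, 18 ≤ k → ∃ d ∈ borders,
    MarkerCriterion (fun a => pack (d.word a) 11 tmBits) k d.marker d.offset d.len := by
  decide +kernel

lemma existsUniform_of_lt {k : ℕ} (hk : k < 59) : ExistsUniform k := by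
  by_cases h : 18 ≤ k
  · obtain ⟨d, -, hd⟩ := exists_border_markerCriterion k hk h
    exact existsUniform_of_markerCriterion hd
  · interval_cases k
    · exact existsUniform_zero
    · exact existsUniform_one
    · exact existsUniform_of_synchronizing (B := bitPair 2 1) (l := 4) (by decide +kernel)
    · exact existsUniform_of_markerCriterion (B := bitPair 4 5) (m := 2) (c := 1) (l := 2)
        (by decide +kernel)
    · exact existsUniform_of_synchronizing (B := bitPair 6 9) (l := 7) (by decide +kernel)
    · exact existsUniform_of_synchronizing (B := bitPair 18 13) (l := 6) (by decide +kernel)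
    · exact existsUniform_of_markerCriterion (B := bitPair 52 44) (m := 0) (c := 0) (l := 2)
        (by decide +kernel)
    · exact existsUniform_of_synchronizing (B := bitPair 100 108) (l := 7) (by decide +kernel)
    · exact existsUniform_of_synchronizing (B := bitPair 150 105) (l := 13) (by decide +kernel)
    · exact existsUniform_of_markerCriterion (B := bitPair 420 404) (m := 3) (c := 7) (l := 2)
        (by decide +kernel)
    · exact existsUniform_of_markerCriterion (B := bitPair 868 820) (m := 2) (c := 1) (l := 3)
        (by decide +kernel)
    · exact existsUniform_of_markerCriterion (B := bitPair 1684 1428) (m := 10) (c := 1) (l := 5)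
        (by decide +kernel)
    · exact existsUniform_of_markerCriterion (B := bitPair 3236 3492) (m := 10) (c := 4) (l := 4)
        (by decide +kernel)
    · exact existsUniform_of_markerCriterion (B := bitPair 6564 6756) (m := 2) (c := 1) (l := 4)
        (by decide +kernel)
    · exact existsUniform_of_markerCriterion (B := bitPair 13476 13732) (m := 4) (c := 0) (l := 5)
        (by decide +kernel)
    · exact existsUniform_of_markerCriterion (B := bitPair 25764 27812) (m := 10) (c := 4) (l := 4)
        (by decide +kernel)
    · exact existsUniform_of_markerCriterion (B := bitPair 51620 55716) (m := 10) (c := 4) (l := 4)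
        (by decide +kernel)
    · exact existsUniform_of_markerCriterion (B := bitPair 111780 109732) (m := 4) (c := 0)
        (l := 5) (by decide +kernel)

theorem stmt6 (k : ℕ) :
    ∃ h : Bool → List Bool,
      (h false).length = k ∧ (h true).length = k ∧ CubefreeMorphism h := by
  rcases lt_or_ge k 59 with hk | hk
  · exact existsUniform_of_lt hk
  · obtain ⟨n, rfl⟩ : ∃ n, k = n + 11 := ⟨k - 11, by omega⟩
    obtain ⟨d, s, hd, hs⟩ := exists_compatible_border_of_tm (n - 48)
    exact existsUniform_of_prefixWord (hd.cubefreeMorphism (by omega) hs)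
end

section
/- The 5-uniform binary morphism φ₅ defined by φ₅(0) = 01001 and φ₅(1) = 10110 is cubefree: φ₅(w) is cubefree for every cubefree binary word w. -/
theorem getElem?_add_length_of_cube (a x b : List Bool) {n : ℕ} (h₁ : a.length ≤ n)
    (h₂ : n < a.length + 2 * x.length) :
    (a ++ (x ++ x ++ x) ++ b)[n]? = (a ++ (x ++ x ++ x) ++ b)[n + x.length]? := by
  obtain ⟨k, rfl⟩ := Nat.exists_eq_add_of_le h₁
  simp only [List.append_assoc, Nat.add_assoc]
  have hr : (a ++ (x ++ (x ++ (x ++ b))))[a.length + (k + x.length)]? = (x ++ (x ++ b))[k]? := by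
    rw [List.getElem?_append_right (by omega), List.getElem?_append_right (by omega)]
    congr 1
    omega
  rw [hr, List.getElem?_append_right (by omega), Nat.add_sub_cancel_left]
  by_cases hk : k < x.length
  · rw [List.getElem?_append_left hk, List.getElem?_append_left hk]
  · rw [List.getElem?_append_right (by omega), List.getElem?_append_left (by omega),
      List.getElem?_append_right (by omega), List.getElem?_append_left (by omega)]

theorem Cubefree.not_periodic {w : List Bool} (hw : Cubefree w) {a q : ℕ} (hq : 0 < q)
    (hlen : a + 3 * q ≤ w.length) :
    ¬ ∀ i, a ≤ i → i < a + 2 * q → w[i]? = w[i + q]? := by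
  intro hper
  have htake : ∀ k, k + q ≤ 2 * q → (w.drop (a + k)).take q = (w.drop a).take q →
      (w.drop (a + (k + q))).take q = (w.drop a).take q := by
    intro k hkq hk
    rw [← hk]
    refine List.ext_getElem? fun i => ?_
    simp only [List.getElem?_take, List.getElem?_drop]
    split_ifs with hi
    · rw [hper (a + k + i) (by omega) (by omega)]
      congr 1
      omega
    · rfl
  have h₁ := htake 0 (by omega) rfl
  have h₂ := htake (0 + q) (by omega) h₁
  refine hw ((w.drop a).take q) ?_ ?_
  · intro h
    have := congrArg List.length h
    simp at this
    omega
  · have hsplit : (w.drop a).take q ++ (w.drop a).take q ++ (w.drop a).take q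
        = (w.drop a).take (q + q + q) := by
      rw [List.take_add, List.take_add, List.drop_drop, List.drop_drop]
      simp only [Nat.zero_add] at h₁ h₂ ⊢
      rw [h₁, h₂]
    rw [hsplit]
    exact (List.take_prefix _ _).isInfix.trans (List.drop_suffix _ _).isInfix

theorem getElem?_flatMap_five (w : List Bool) (n : ℕ) :
    (w.flatMap fun b => if b then [true, false, true, true, false]
      else [false, true, false, false, true])[n]?
      = w[n / 5]?.map (fun b => b ^^ (n % 5 == 1 || n % 5 == 4)) := by
  induction w generalizing n with
  | nil => simp
  | cons b w ih =>
    rw [List.flatMap_cons]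
    by_cases hn : n < 5
    · rw [List.getElem?_append_left (by cases b <;> simpa using hn)]
      cases b <;> interval_cases n <;> rfl
    · obtain ⟨m, rfl⟩ := Nat.exists_eq_add_of_le (not_lt.mp hn)
      rw [List.getElem?_append_right (by cases b <;> simp)]
      have hm : 5 + m - (if b then [true, false, true, true, false]
          else [false, true, false, false, true]).length = m := by cases b <;> simp
      rw [hm, ih, show (5 + m) / 5 = m / 5 + 1 by omega, show (5 + m) % 5 = m % 5 by omega,
        List.getElem?_cons_succ]

theorem stmt9 :
    CubefreeMorphism (fun b =>
      if b then [true, false, true, true, false]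
      else [false, true, false, false, true]) := by
  rintro w hw x hx ⟨a, b, h⟩
  have hp : 0 < x.length := List.length_pos_iff.mpr hx
  have hl := congrArg List.length h
  have hlen : (w.flatMap fun b => if b then [true, false, true, true, false]
      else [false, true, false, false, true]).length = 5 * w.length := by
    rw [List.length_flatMap, List.map_congr_left (g := fun _ => 5) (by rintro (_ | _) _ <;> rfl)]
    simp [mul_comm]
  rw [hlen] at hl
  simp only [List.length_append] at hl
  have hper : ∀ n, a.length ≤ n → n < a.length + 2 * x.length →
      w[n / 5]?.map (fun b => b ^^ (n % 5 == 1 || n % 5 == 4))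
      = w[(n + x.length) / 5]?.map
        (fun b => b ^^ ((n + x.length) % 5 == 1 || (n + x.length) % 5 == 4)) := by
    intro n h₁ h₂
    rw [← getElem?_flatMap_five, ← getElem?_flatMap_five, ← h]
    exact getElem?_add_length_of_cube a x b h₁ h₂
  generalize a.length = s at *
  generalize x.length = p at *
  generalize hu : (fun n => w[n / 5]?.map (fun b => b ^^ (n % 5 == 1 || n % 5 == 4))) = u
  have hper' : ∀ n, s ≤ n → n < s + 2 * p → u n = u (n + p) := by
    subst hu; exact hper
  have heq : ∀ n, n % 5 = 2 → u n = u (n + 1) := by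
    intro n hn
    subst hu
    simp [show (n + 1) / 5 = n / 5 by omega, show (n + 1) % 5 = 3 by omega, hn]
  have hne : ∀ n, n < s + 3 * p → u n = u (n + 1) → n % 5 = 2 ∨ n % 5 = 4 := by
    intro n hn he
    subst hu
    by_contra hc
    have hd : (n + 1) / 5 = n / 5 := by omega
    have hlt : n / 5 < w.length := by omega
    simp only [hd, List.getElem?_eq_getElem hlt, Option.map_some, Option.some.injEq] at he
    have : n % 5 = 0 ∨ n % 5 = 1 ∨ n % 5 = 3 := by omega
    rcases this with h | h | h
    · simp [h, show (n + 1) % 5 = 1 by omega] at he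
    · simp [h, show (n + 1) % 5 = 2 by omega] at he
    · simp [h, show (n + 1) % 5 = 4 by omega] at he
  have hmod : p % 5 = 0 := by
    obtain rfl | rfl | h3 : p = 1 ∨ p = 2 ∨ 3 ≤ p := by omega
    · have h₁ := hne s (by omega) (hper' s (by omega) (by omega))
      have h₂ := hne (s + 1) (by omega) (hper' (s + 1) (by omega) (by omega))
      omega
    · have e₀ := hper' s (by omega) (by omega)
      have e₁ := hper' (s + 1) (by omega) (by omega)
      have e₂ := hper' (s + 2) (by omega) (by omega)
      have e₃ := hper' (s + 3) (by omega) (by omega)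
      have n₀ := hne s (by omega)
      have n₁ := hne (s + 1) (by omega)
      have n₂ := hne (s + 2) (by omega)
      have n₃ := hne (s + 3) (by omega)
      have n₄ := hne (s + 4) (by omega)
      have q₀ := heq s
      have q₁ := heq (s + 1)
      have q₂ := heq (s + 2)
      have q₃ := heq (s + 3)
      have q₄ := heq (s + 4)
      simp only [Nat.add_assoc, Nat.reduceAdd] at *
      grind
    · obtain ⟨n, hn₁, hn₂, hn⟩ : ∃ n, s ≤ n ∧ n < s + 5 ∧ n % 5 = 2 :=
        ⟨s + (7 - s % 5) % 5, by omega, by omega, by omega⟩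
      obtain ⟨m, hm₁, hm₂, hm⟩ : ∃ m, s ≤ m ∧ m < s + 5 ∧ (m + p) % 5 = 2 :=
        ⟨s + (7 - (s + p) % 5) % 5, by omega, by omega, by omega⟩
      have h₁ := hne (n + p) (by omega) (by
        rw [← hper' n hn₁ (by omega), heq n hn, hper' (n + 1) (by omega) (by omega),
          Nat.add_right_comm])
      have h₂ := hne m (by omega) (by
        rw [hper' m hm₁ (by omega), hper' (m + 1) (by omega) (by omega), heq _ hm,
          Nat.add_right_comm])
      omega
  obtain ⟨q, rfl⟩ := Nat.dvd_of_mod_eq_zero hmod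
  refine hw.not_periodic (a := s / 5) (q := q) (by omega) (by omega) fun i h₁ h₂ => ?_
  have he := hper (5 * i + s % 5) (by omega) (by omega)
  rw [show (5 * i + s % 5 + 5 * q) / 5 = i + q by omega,
    show (5 * i + s % 5 + 5 * q) % 5 = (5 * i + s % 5) % 5 by omega,
    show (5 * i + s % 5) / 5 = i by omega] at he
  exact Option.map_injective (fun _ _ hb => Bool.xor_left_inj.mp hb) he
end

section
/- The 7-uniform binary morphism φ₇ defined by φ₇(0) = 0010011 and φ₇(1) = 0011011 is cubefree: φ₇(w) is cubefree for every cubefree binary word w. -/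
theorem cubefree_iff_getElem? (w : List Bool) :
    Cubefree w ↔ ∀ i p, 0 < p → i + 3 * p ≤ w.length →
      ∃ n, i ≤ n ∧ n < i + 2 * p ∧ w[n]? ≠ w[n + p]? := by
  constructor
  · intro hw i p hp hi
    by_contra! h
    refine hw ((w.drop i).take p) (by simp; omega) ?_
    suffices (w.drop i).take p ++ (w.drop i).take p ++ (w.drop i).take p
        = (w.drop i).take (3 * p) by
      rw [this]
      exact (List.take_prefix _ _).isInfix.trans (List.drop_suffix _ _).isInfix
    apply List.ext_getElem?
    intro n
    have hlen : ((w.drop i).take p).length = p := by simp; omega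
    rcases lt_or_ge n p with h1 | h1
    · grind
    rcases lt_or_ge n (2 * p) with h2 | h2
    · have := h (i + (n - p)) (by omega) (by omega)
      grind
    rcases lt_or_ge n (3 * p) with h3 | h3
    · have := h (i + (n - p)) (by omega) (by omega)
      have := h (i + (n - 2 * p)) (by omega) (by omega)
      grind
    · grind
  · rintro hw x hx ⟨s, t, rfl⟩
    obtain ⟨n, h1, h2, h3⟩ := hw s.length x.length (List.length_pos_of_ne_nil hx)
      (by simp; omega)
    obtain ⟨m, rfl⟩ := Nat.exists_eq_add_of_le h1
    apply h3
    rcases lt_or_ge m x.length with h | h <;> grind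

/-- The block `001c011`: the image of the letter `c` under the morphism `φ₇`. -/
def phi7Block (c : Bool) : List Bool := [false, false, true, c, false, true, true]

theorem length_flatMap_phi7Block (w : List Bool) :
    (w.flatMap phi7Block).length = 7 * w.length := by
  induction w with
  | nil => rfl
  | cons a w ih => simp [ih, phi7Block]; omega

theorem getElem?_flatMap_phi7Block (w : List Bool) {k j : ℕ} (hj : j < 7) :
    (w.flatMap phi7Block)[7 * k + j]? = w[k]?.bind fun c => (phi7Block c)[j]? := by
  induction w generalizing k with
  | nil => simp
  | cons a w ih =>
    rw [List.flatMap_cons]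
    cases k with
    | zero => rw [List.getElem?_append_left (by simp [phi7Block]; omega)]; simp
    | succ k =>
      rw [List.getElem?_append_right (by simp [phi7Block]; omega), List.getElem?_cons_succ, ← ih]
      congr 1
      simp [phi7Block]; omega

/-- No cube in a `φ₇`-image has a period that is not a multiple of `7`. -/
theorem seven_dvd_of_period_phi7 {w : List Bool} {i p : ℕ} (hp : 0 < p)
    (hi : i + 3 * p ≤ 7 * w.length)
    (h : ∀ n, i ≤ n → n < i + 2 * p →
      (w.flatMap phi7Block)[n]? = (w.flatMap phi7Block)[n + p]?) : 7 ∣ p := by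
  have fixed (n : ℕ) (hn : n < 7 * w.length) (h3 : n % 7 ≠ 3) :
      (w.flatMap phi7Block)[n]? = some (decide (n % 7 = 2 ∨ n % 7 = 5 ∨ n % 7 = 6)) := by
    have hlt := Nat.mod_lt n (show 7 > 0 by norm_num)
    have hk : n / 7 < w.length := by omega
    conv_lhs => rw [← Nat.div_add_mod n 7]
    rw [getElem?_flatMap_phi7Block w hlt, List.getElem?_eq_getElem hk]
    generalize n % 7 = r at *
    interval_cases r <;> simp_all [phi7Block]
  have agree (n : ℕ) (h1 : i ≤ n) (h2 : n < i + 2 * p) (h3 : n % 7 ≠ 3)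
      (h4 : (n + p) % 7 ≠ 3) : (n % 7 = 2 ∨ n % 7 = 5 ∨ n % 7 = 6) ↔
        ((n + p) % 7 = 2 ∨ (n + p) % 7 = 5 ∨ (n + p) % 7 = 6) := by
    have := h n h1 h2
    rw [fixed n (by omega) h3, fixed (n + p) (by omega) h4] at this
    exact decide_eq_decide.mp (Option.some.inj this)
  -- When the middle position of a triple `n, n + p, n + 2 * p` is variable, compare its ends.
  have agree₂ (n : ℕ) (h1 : i ≤ n) (h2 : n < i + p) (h3 : n % 7 ≠ 3)
      (h4 : (n + 2 * p) % 7 ≠ 3) : (n % 7 = 2 ∨ n % 7 = 5 ∨ n % 7 = 6) ↔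
        ((n + 2 * p) % 7 = 2 ∨ (n + 2 * p) % 7 = 5 ∨ (n + 2 * p) % 7 = 6) := by
    have := (h n h1 (by omega)).trans (h (n + p) (by omega) (by omega))
    rw [add_assoc, ← two_mul, fixed n (by omega) h3, fixed (n + 2 * p) (by omega) h4] at this
    exact decide_eq_decide.mp (Option.some.inj this)
  by_contra hd
  rcases lt_or_ge p 4 with hp4 | hp4
  · have hr := Nat.mod_lt i (show 7 > 0 by norm_num)
    have a0 := agree i
    have a1 := agree (i + 1)
    have a2 := agree (i + 2)
    have a3 := agree (i + 3)
    have a4 := agree (i + 4)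
    have a5 := agree (i + 5)
    have b0 := agree₂ i
    have b1 := agree₂ (i + 1)
    clear agree agree₂ fixed h hi
    interval_cases p <;> generalize hri : i % 7 = r at * <;> interval_cases r <;>
      simp [Nat.add_mod, hri] at *
  · have window (r : ℕ) (hr : r < 7) : ∃ n, i ≤ n ∧ n < i + 2 * p ∧ n % 7 = r :=
      ⟨i + (r + 7 - i % 7) % 7, by omega, by omega, by omega⟩
    obtain ⟨n₀, h0, h0', e0⟩ := window 0 (by norm_num)
    obtain ⟨n₁, h1, h1', e1⟩ := window 1 (by norm_num)
    obtain ⟨n₅, h5, h5', e5⟩ := window 5 (by norm_num)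
    have c0 := agree n₀ h0 h0'
    have c1 := agree n₁ h1 h1'
    have c5 := agree n₅ h5 h5'
    omega

theorem cubefreeMorphism_phi7Block : CubefreeMorphism phi7Block := by
  intro w hw
  rw [cubefree_iff_getElem?] at hw ⊢
  intro i p hp hi
  by_contra! h
  rw [length_flatMap_phi7Block] at hi
  obtain ⟨q, rfl⟩ := seven_dvd_of_period_phi7 hp hi h
  -- The first position `≥ i` in residue class `3` is `7 * ((i + 3) / 7) + 3`.
  obtain ⟨n, h1, h2, h3⟩ := hw ((i + 3) / 7) q (by omega) (by omega)
  have hc := h (7 * n + 3) (by omega) (by omega)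
  rw [show 7 * n + 3 + 7 * q = 7 * (n + q) + 3 by ring,
    getElem?_flatMap_phi7Block w (by norm_num), getElem?_flatMap_phi7Block w (by norm_num)] at hc
  exact h3 (by simpa [phi7Block] using hc)

theorem stmt10 :
    CubefreeMorphism (fun b =>
      if b then [false, false, true, true, false, true, true]
      else [false, false, true, false, false, true, true]) := by
  convert cubefreeMorphism_phi7Block using 2 with b
  cases b <;> rfl
end
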